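/- Let s ≥ 0 be an integer, X₀ ≠ 0 real with inf_{p∈ℤ}|Δ^TE_p| > 0, and X₁ ∈ C^s([0,d]) a d-periodic function. Define the sequence (U_ℓ, W_ℓ), ℓ ≥ 0, by the TE recursion: U_ℓ − W_ℓ = δ_{ℓ,0} ξ and G₀U_ℓ + J₀W_ℓ − ik₀X₀(σ̂_loc W_ℓ − σ̂_nloc ∂ₓ² W_ℓ) = −δ_{ℓ,0} ν + ik₀ X₁(x)(σ̂_loc W_{ℓ−1} − σ̂_nloc ∂ₓ² W_{ℓ−1}), with W_{−1} ≡ 0, where ξ = −e^{iαx} and ν = iγ_{u,0} e^{iαx}. Then this recursion has a unique solution with U_ℓ ∈ H^{s+1} and W_ℓ ∈ H^{s+2} for every ℓ, and there exist constants C_U, C_W, C > 0 such that for every D > C·|X₁|_{C^s} one has ‖U_ℓ‖_{H^{s+1}} ≤ C_U D^ℓ and ‖W_ℓ‖_{H^{s+2}} ≤ C_W D^ℓ for all ℓ ≥ 0; in particular the series Σ_ℓ U_ℓ δ^ℓ and Σ_ℓ W_ℓ δ^ℓ converge in H^{s+1} and H^{s+2} respectively for δ·C·|X₁|_{C^s}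 < 1. -/

import Mathlib

open Real Complex

/-- The vertical wavenumber. -/
noncomputable def gamC (k a : ℝ) : ℂ :=
  if a ^ 2 ≤ k ^ 2 then ((Real.sqrt (k ^ 2 - a ^ 2) : ℝ) : ℂ)
  else Complex.I * ((Real.sqrt (a ^ 2 - k ^ 2) : ℝ) : ℂ)

/-- The transverse-electric determinant. -/
noncomputable def DeltaTE (d α ku kw k₀ X₀ : ℝ) (σl σn : ℂ) (p : ℤ) : ℂ :=
  -Complex.I * gamC ku (α + (2 * π / d) * p)
    - Complex.I * gamC kw (α + (2 * π / d) * p)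
    - Complex.I * (k₀ : ℂ) * σl * (X₀ : ℂ)
    - Complex.I * (k₀ : ℂ) * σn * (X₀ : ℂ) * ((((α + (2 * π / d) * p) ^ 2 : ℝ)) : ℂ)

/-- The `k`-th Fourier coefficient of the `d`-periodic envelope `X₁`. -/
noncomputable def envCoeff (d : ℝ) (X : ℝ → ℝ) (k : ℤ) : ℂ :=
  (1 / (d : ℂ)) * ∫ x in (0 : ℝ)..d,
    (X x : ℂ) * Complex.exp (-Complex.I * (2 * π / d : ℝ) * (k : ℂ) * (x : ℂ))

/-- The Hölder norm `|X|_{C^s} = max_{0 ≤ ℓ ≤ s} sup_x |∂ₓ^ℓ X(x)|`. -/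
noncomputable def holderNorm (s : ℕ) (X : ℝ → ℝ) : ℝ :=
  ⨆ (ℓ : Fin (s + 1)) (x : ℝ), |iteratedDeriv (ℓ : ℕ) X x|

/-- The squared periodic Sobolev norm `‖U‖²_{H^s} = Σ_p ⟨p⟩^{2s}|Û_p|²`. -/
noncomputable def hnormSq (s : ℝ) (U : ℤ → ℂ) : ℝ :=
  ∑' p : ℤ, (1 + |(p : ℝ)| ^ 2) ^ s * ‖U p‖ ^ 2

/-- The TE HOPE recursion: at order `ℓ`, mode `p`:
`Û_{ℓ,p} − Ŵ_{ℓ,p} = δ_{ℓ,0} ξ̂_p` and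
`−iγ_{u,p}Û_{ℓ,p} + (−iγ_{w,p} − ik₀X₀(σ̂_loc + σ̂_nloc α_p²))Ŵ_{ℓ,p}
  = −δ_{ℓ,0} ν̂_p + ik₀ [X₁ · (σ̂_loc W_{ℓ−1} − σ̂_nloc ∂ₓ² W_{ℓ−1})]ˆ_p`,
with `ξ = −e^{iαx}`, `ν = iγ_{u,0}e^{iαx}`, and `W_{−1} ≡ 0`. -/
def teRec (d α ku kw k₀ X₀ : ℝ) (σl σn : ℂ) (X₁ : ℝ → ℝ)
    (UW : ℕ → (ℤ → ℂ) × (ℤ → ℂ)) : Prop :=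
  ∀ ℓ : ℕ, ∀ p : ℤ,
    ((UW ℓ).1 p - (UW ℓ).2 p =
      if ℓ = 0 then (if p = 0 then (-1 : ℂ) else 0) else 0) ∧
    ((-Complex.I * gamC ku (α + (2 * π / d) * p)) * (UW ℓ).1 p
      + (-Complex.I * gamC kw (α + (2 * π / d) * p)
          - Complex.I * (k₀ : ℂ) * (X₀ : ℂ) *
            (σl + σn * ((((α + (2 * π / d) * p) ^ 2 : ℝ)) : ℂ))) * (UW ℓ).2 p
      = if ℓ = 0 then -(if p = 0 then Complex.I * gamC ku α else 0)
        else Complex.I * (k₀ : ℂ) *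
          ∑' q : ℤ, envCoeff d X₁ (p - q) *
            (σl + σn * ((((α + (2 * π / d) * q) ^ 2 : ℝ)) : ℂ)) * (UW (ℓ - 1)).2 q)

section FourierMultiplication

open MeasureTheory AddCircle

/-- Multiplication by a continuous function on the circle acts on Fourier coefficients as
convolution, and is bounded on `ℓ²` by the sup norm of the function. -/
theorem AddCircle.conv_fourierCoeff_bound {T : ℝ} [Fact (0 < T)] (Y : C(AddCircle T, ℂ)) {M : ℝ}
    (hM : ∀ t, ‖Y t‖ ≤ M) (f : ℤ → ℂ) (hf : Summable fun q => ‖f q‖ ^ 2) :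
    (∀ p : ℤ, Summable fun q : ℤ => fourierCoeff Y (p - q) * f q) ∧
      (Summable fun p : ℤ => ‖∑' q : ℤ, fourierCoeff Y (p - q) * f q‖ ^ 2) ∧
      ∑' p : ℤ, ‖∑' q : ℤ, fourierCoeff Y (p - q) * f q‖ ^ 2 ≤ M ^ 2 * ∑' q, ‖f q‖ ^ 2 := by
  have htwo : (0 : ℝ) < (2 : ENNReal).toReal := by norm_num
  have hf' : Memℓp f 2 := by
    rw [memℓp_gen_iff htwo]
    simpa using hf
  set F : Lp ℂ 2 (haarAddCircle (T := T)) := fourierBasis.repr.symm ⟨f, hf'⟩ with hF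
  have hcoeff : ∀ q, inner ℂ (fourierBasis (T := T) q) F = f q := by
    intro q
    rw [← HilbertBasis.repr_apply_apply, hF, LinearIsometryEquiv.apply_symm_apply]
  have hle : ∀ᵐ t ∂(haarAddCircle (T := T)), ‖Y t * F t‖ ≤ M * ‖F t‖ := by
    refine Filter.Eventually.of_forall fun t => ?_
    rw [norm_mul]
    exact mul_le_mul_of_nonneg_right (hM t) (norm_nonneg _)
  have hmem : MemLp (fun t => Y t * F t) 2 (haarAddCircle (T := T)) :=
    (Lp.memLp F).of_le_mul
      (Y.continuous.aestronglyMeasurable.mul (Lp.memLp F).aestronglyMeasurable) hle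
  set G : Lp ℂ 2 (haarAddCircle (T := T)) := hmem.toLp _ with hG
  have hGF : ‖G‖ ≤ M * ‖F‖ := by
    refine Lp.norm_le_mul_norm_of_ae_le_mul ?_
    filter_upwards [hmem.coeFn_toLp, hle] with t ht hle
    rw [hG, ht]
    exact hle
  have hsum : ∀ p : ℤ, HasSum (fun q : ℤ => fourierCoeff Y (p - q) * f q)
      (fourierBasis.repr G p) := by
    intro p
    set H : C(AddCircle T, ℂ) := star Y * fourier p with hH
    have h := fourierBasis.hasSum_inner_mul_inner
      (ContinuousMap.toLp (E := ℂ) 2 haarAddCircle ℂ H) F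
    have h₁ : inner ℂ (ContinuousMap.toLp (E := ℂ) 2 haarAddCircle ℂ H) F
        = fourierBasis.repr G p := by
      rw [fourierBasis_repr, fourierCoeff, L2.inner_def]
      refine integral_congr_ae ?_
      filter_upwards [hmem.coeFn_toLp, ContinuousMap.coeFn_toLp (p := 2) (𝕜 := ℂ) haarAddCircle H]
        with t ht hHt
      rw [hHt, hG, ht, fourier_neg, hH]
      simp only [RCLike.inner_apply, ContinuousMap.mul_apply, ContinuousMap.star_apply, map_mul,
        RCLike.star_def, Complex.conj_conj, smul_eq_mul]
      ring
    rw [h₁] at h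
    refine h.congr_fun fun q => ?_
    rw [hcoeff, coe_fourierBasis, fourierLp, ContinuousMap.inner_toLp, fourierCoeff]
    congr 1
    refine integral_congr_ae (Filter.Eventually.of_forall fun t => ?_)
    have : -(p - q) = q + -p := by ring
    simp only [this, fourier_add, fourier_neg, hH, ContinuousMap.mul_apply,
      ContinuousMap.star_apply, map_mul, RCLike.star_def, Complex.conj_conj, smul_eq_mul]
    ring
  have hnorm : ∀ g : lp (fun _ : ℤ => ℂ) 2, HasSum (fun p => ‖g p‖ ^ 2) (‖g‖ ^ 2) := by
    intro g
    have := lp.hasSum_norm htwo g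
    simpa using this
  have hGsum : HasSum (fun p : ℤ => ‖∑' q : ℤ, fourierCoeff Y (p - q) * f q‖ ^ 2) (‖G‖ ^ 2) := by
    have := hnorm (fourierBasis.repr G)
    rw [LinearIsometryEquiv.norm_map] at this
    exact this.congr_fun fun p => by rw [(hsum p).tsum_eq]
  have hFsum : ∑' q, ‖f q‖ ^ 2 = ‖F‖ ^ 2 := by
    have := hnorm (fourierBasis.repr F)
    rw [LinearIsometryEquiv.norm_map] at this
    rw [← this.tsum_eq, hF, LinearIsometryEquiv.apply_symm_apply]
  refine ⟨fun p => (hsum p).summable, hGsum.summable, ?_⟩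
  rw [hGsum.tsum_eq, hFsum, ← mul_pow]
  gcongr

theorem envCoeff_eq_fourierCoeff {d : ℝ} [Fact (0 < d)] (X : ℝ → ℝ) (Y : AddCircle d → ℂ)
    (hY : ∀ x : ℝ, Y x = X x) (k : ℤ) : envCoeff d X k = fourierCoeff Y k := by
  rw [fourierCoeff_eq_intervalIntegral Y k 0, envCoeff, zero_add, Complex.real_smul]
  push_cast
  congr 1
  refine intervalIntegral.integral_congr fun x _ => ?_
  simp only [hY, fourier_coe_apply, smul_eq_mul]
  rw [mul_comm]
  congr 2
  push_cast
  ring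

/-- Multiplication by a bounded continuous periodic function is bounded on `ℓ²` sequences of
Fourier coefficients. -/
theorem conv_envCoeff_bound {d : ℝ} (hd : 0 < d) (X : ℝ → ℝ) (hX : Continuous X)
    (hper : Function.Periodic X d) {M : ℝ} (hM : ∀ x, |X x| ≤ M) (f : ℤ → ℂ)
    (hf : Summable fun q => ‖f q‖ ^ 2) :
    (∀ p : ℤ, Summable fun q : ℤ => envCoeff d X (p - q) * f q) ∧
      (Summable fun p : ℤ => ‖∑' q : ℤ, envCoeff d X (p - q) * f q‖ ^ 2) ∧
      ∑' p : ℤ, ‖∑' q : ℤ, envCoeff d X (p - q) * f q‖ ^ 2 ≤ M ^ 2 * ∑' q, ‖f q‖ ^ 2 := by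
  have : Fact (0 < d) := ⟨hd⟩
  have hper' : Function.Periodic (fun x => (X x : ℂ)) d := fun x => by simp [hper x]
  have hcont : Continuous (fun x => (X x : ℂ)) := Complex.continuous_ofReal.comp hX
  let Y : C(AddCircle d, ℂ) := ⟨hper'.lift, continuous_coinduced_dom.mpr hcont⟩
  have hY : ∀ x : ℝ, Y x = X x := fun x => hper'.lift_coe x
  have hMY : ∀ t, ‖Y t‖ ≤ M := by
    intro t
    induction t using QuotientAddGroup.induction_on with
    | H x =>
      rw [hY]
      simpa using hM x
  simp only [envCoeff_eq_fourierCoeff X Y hY]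
  exact AddCircle.conv_fourierCoeff_bound Y hMY f hf

theorem envCoeff_deriv {d : ℝ} (hd : 0 < d) (X : ℝ → ℝ) (hX : ContDiff ℝ 1 X)
    (hper : Function.Periodic X d) (k : ℤ) :
    envCoeff d (deriv X) k = Complex.I * (2 * π / d : ℝ) * k * envCoeff d X k := by
  set c : ℂ := -Complex.I * (2 * π / d : ℝ) * (k : ℂ) with hc
  have hdc : (d : ℂ) ≠ 0 := by exact_mod_cast hd.ne'
  have hu : ∀ x : ℝ, HasDerivAt (fun x : ℝ => Complex.exp (c * x)) (c * Complex.exp (c * x)) x := by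
    intro x
    have := ((Complex.ofRealCLM.hasDerivAt (x := x)).const_mul c).cexp
    simpa [mul_comm] using this
  have hv : ∀ x : ℝ, HasDerivAt (fun x : ℝ => (X x : ℂ)) ((deriv X x : ℝ) : ℂ) x := fun x =>
    ((hX.differentiable (by norm_num)) x).hasDerivAt.ofReal_comp
  have hX' : Continuous (deriv X) := hX.continuous_deriv (by norm_num)
  have h := intervalIntegral.integral_mul_deriv_eq_deriv_mul (a := 0) (b := d)
    (fun x _ => hu x) (fun x _ => hv x)
    (Continuous.intervalIntegrable (by fun_prop) _ _)
    (Continuous.intervalIntegrable (Complex.continuous_ofReal.comp hX') _ _)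
  have hcd : Complex.exp (c * d) = 1 := by
    rw [Complex.exp_eq_one_iff]
    refine ⟨-k, ?_⟩
    rw [hc]
    push_cast
    field_simp
  have hX0 : X d = X 0 := by simpa using hper 0
  rw [hcd, hX0, Complex.ofReal_zero, mul_zero, Complex.exp_zero, sub_self, zero_sub] at h
  have h₁ : ∫ x in (0 : ℝ)..d, ((deriv X x : ℝ) : ℂ) * Complex.exp (c * x)
      = -(c * ∫ x in (0 : ℝ)..d, (X x : ℂ) * Complex.exp (c * x)) := by
    rw [← intervalIntegral.integral_const_mul]
    calc ∫ x in (0 : ℝ)..d, ((deriv X x : ℝ) : ℂ) * Complex.exp (c * x)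
        = ∫ x in (0 : ℝ)..d, Complex.exp (c * x) * ((deriv X x : ℝ) : ℂ) :=
          intervalIntegral.integral_congr fun x _ => mul_comm _ _
      _ = -∫ x in (0 : ℝ)..d, c * Complex.exp (c * x) * (X x : ℂ) := h
      _ = -∫ x in (0 : ℝ)..d, c * ((X x : ℂ) * Complex.exp (c * x)) := by
          congr 1
          exact intervalIntegral.integral_congr fun x _ => by ring
  rw [envCoeff, envCoeff, ← hc, h₁, hc]
  ring

end FourierMultiplication

section Sobolev

/-- The `p`-th summand of the squared Sobolev norm of integer order `s`. -/
noncomputable def sobolevTerm (s : ℕ) (f : ℤ → ℂ) (p : ℤ) : ℝ :=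
  (1 + (p : ℝ) ^ 2) ^ s * ‖f p‖ ^ 2

/-- The Fourier coefficients of the product of `X` with the function with coefficients `f`. -/
noncomputable def envConv (d : ℝ) (X : ℝ → ℝ) (f : ℤ → ℂ) (p : ℤ) : ℂ :=
  ∑' q : ℤ, envCoeff d X (p - q) * f q

theorem sobolevTerm_nonneg (s : ℕ) (f : ℤ → ℂ) (p : ℤ) : 0 ≤ sobolevTerm s f p := by
  unfold sobolevTerm
  positivity

theorem sobolevTerm_mono {s t : ℕ} (h : s ≤ t) (f : ℤ → ℂ) (p : ℤ) :
    sobolevTerm s f p ≤ sobolevTerm t f p := by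
  unfold sobolevTerm
  gcongr
  nlinarith [sq_nonneg (p : ℝ)]

theorem sobolevTerm_succ (s : ℕ) (f : ℤ → ℂ) (p : ℤ) :
    sobolevTerm (s + 1) f p = sobolevTerm s f p + sobolevTerm s (fun q => (q : ℂ) * f q) p := by
  simp only [sobolevTerm, norm_mul, Complex.norm_intCast, mul_pow, sq_abs]
  ring

theorem Function.Periodic.deriv {X : ℝ → ℝ} {d : ℝ} (h : Function.Periodic X d) :
    Function.Periodic (deriv X) d := by
  intro x
  rw [← deriv_comp_add_const, funext h]

theorem Function.Periodic.iteratedDeriv {X : ℝ → ℝ} {d : ℝ} (h : Function.Periodic X d) (j : ℕ) :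
    Function.Periodic (iteratedDeriv j X) d := by
  induction j with
  | zero => simpa using h
  | succ j ih =>
    rw [iteratedDeriv_succ]
    exact ih.deriv

theorem abs_iteratedDeriv_le_holderNorm {d : ℝ} (hd : 0 < d) {s : ℕ} {X : ℝ → ℝ}
    (hX : ContDiff ℝ s X) (hper : Function.Periodic X d) {j : ℕ} (hj : j ≤ s) (x : ℝ) :
    |iteratedDeriv j X x| ≤ holderNorm s X := by
  have hbdd : BddAbove (Set.range fun x => |iteratedDeriv j X x|) := by
    have hcont := hX.continuous_iteratedDeriv j (by exact_mod_cast hj)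
    obtain ⟨B, hB⟩ := ((hper.iteratedDeriv j).isBounded_of_continuous hd.ne'
      hcont).exists_norm_le
    refine ⟨B, ?_⟩
    rintro _ ⟨y, rfl⟩
    exact hB _ ⟨y, rfl⟩
  calc |iteratedDeriv j X x| ≤ ⨆ y, |iteratedDeriv j X y| := le_ciSup hbdd x
    _ ≤ holderNorm s X :=
      le_ciSup (f := fun ℓ : Fin (s + 1) => ⨆ y, |iteratedDeriv (ℓ : ℕ) X y|)
        (Set.finite_range _).bddAbove ⟨j, Nat.lt_succ_of_le hj⟩

theorem summable_norm_sq_of_sobolevTerm {s : ℕ} {f : ℤ → ℂ} (hf : Summable (sobolevTerm s f)) :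
    Summable fun q => ‖f q‖ ^ 2 := by
  refine hf.of_nonneg_of_le (fun q => by positivity) fun q => ?_
  simpa [sobolevTerm] using sobolevTerm_mono (Nat.zero_le s) f q

theorem mul_envConv {d : ℝ} (hd : 0 < d) {X : ℝ → ℝ} (hX : ContDiff ℝ 1 X)
    (hper : Function.Periodic X d) {M : ℝ} (hM : ∀ x, |X x| ≤ M) (hM' : ∀ x, |deriv X x| ≤ M)
    {f : ℤ → ℂ} (hf : Summable fun q => ‖f q‖ ^ 2)
    (hqf : Summable fun q : ℤ => ‖(q : ℂ) * f q‖ ^ 2) (p : ℤ) :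
    (p : ℂ) * envConv d X f p = (Complex.I * (2 * π / d : ℝ))⁻¹ * envConv d (deriv X) f p
      + envConv d X (fun q => (q : ℂ) * f q) p := by
  have h₀ := (conv_envCoeff_bound hd X hX.continuous hper hM f hf).1 p
  have h₁ := (conv_envCoeff_bound hd (deriv X) (hX.continuous_deriv (by norm_num))
    hper.deriv hM' f hf).1 p
  have h₂ := (conv_envCoeff_bound hd X hX.continuous hper hM _ hqf).1 p
  unfold envConv
  rw [← h₁.tsum_mul_left, ← h₀.tsum_mul_left, ← (h₁.mul_left _).tsum_add h₂]
  refine tsum_congr fun q => ?_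
  have hne : Complex.I * ((2 * π / d : ℝ) : ℂ) ≠ 0 := by
    refine mul_ne_zero Complex.I_ne_zero ?_
    exact_mod_cast (by positivity : (2 * π / d : ℝ) ≠ 0)
  rw [envCoeff_deriv hd X hX hper]
  rw [show ∀ a b c e : ℂ, a⁻¹ * (a * b * c * e) = a⁻¹ * a * (b * c * e) by intros; ring,
    inv_mul_cancel₀ hne]
  push_cast
  ring

/-- Multiplication by a `C^s` periodic function is bounded on the Sobolev space of order `s`. -/
theorem sobolev_envConv_bound {d : ℝ} (hd : 0 < d) (s : ℕ) :
    ∃ K : ℝ, 0 < K ∧ ∀ (X : ℝ → ℝ) (M : ℝ), ContDiff ℝ s X → Function.Periodic X d →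
      (∀ j ≤ s, ∀ x, |iteratedDeriv j X x| ≤ M) →
      ∀ f : ℤ → ℂ, Summable (sobolevTerm s f) →
        Summable (sobolevTerm s (envConv d X f)) ∧
          ∑' p, sobolevTerm s (envConv d X f) p ≤ K * M ^ 2 * ∑' p, sobolevTerm s f p := by
  induction s with
  | zero =>
    refine ⟨1, one_pos, fun X M hX hper hM f hf => ?_⟩
    have := conv_envCoeff_bound hd X hX.continuous hper (fun x => by simpa using hM 0 le_rfl x) f
      (summable_norm_sq_of_sobolevTerm hf)
    have hterm : ∀ g : ℤ → ℂ, sobolevTerm 0 g = fun p => ‖g p‖ ^ 2 := fun g => by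
      funext p
      simp [sobolevTerm]
    simpa only [hterm, envConv, one_mul] using this.2
  | succ s ih =>
    obtain ⟨K, hK, ih⟩ := ih
    set κ : ℂ := (Complex.I * (2 * π / d : ℝ))⁻¹ with hκ
    refine ⟨K * (3 + 2 * ‖κ‖ ^ 2), by positivity, fun X M hX hper hM f hf => ?_⟩
    have hX₁ : ContDiff ℝ 1 X := hX.of_le (by exact_mod_cast Nat.succ_le_succ (Nat.zero_le s))
    have hXs : ContDiff ℝ s X := hX.of_le (by exact_mod_cast Nat.le_succ s)
    have hX' : ContDiff ℝ s (deriv X) := by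
      refine (contDiff_succ_iff_deriv (n := (s : WithTop ℕ∞)).mp ?_).2.2
      exact_mod_cast hX
    have hf₀ : Summable (sobolevTerm s f) :=
      hf.of_nonneg_of_le (sobolevTerm_nonneg s f) (sobolevTerm_mono (Nat.le_succ s) f)
    have hf₁ : Summable (sobolevTerm s fun q => (q : ℂ) * f q) := by
      refine hf.of_nonneg_of_le (sobolevTerm_nonneg s _) fun p => ?_
      rw [sobolevTerm_succ]
      linarith [sobolevTerm_nonneg s f p]
    obtain ⟨hA, hA'⟩ := ih X M hXs hper (fun j hj => hM j (hj.trans (Nat.le_succ s))) f hf₀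
    obtain ⟨hB, hB'⟩ := ih (deriv X) M hX' hper.deriv
      (fun j hj x => by simpa [iteratedDeriv_succ'] using hM (j + 1) (Nat.succ_le_succ hj) x) f hf₀
    obtain ⟨hC, hC'⟩ := ih X M hXs hper (fun j hj => hM j (hj.trans (Nat.le_succ s))) _ hf₁
    have hle : ∀ p, sobolevTerm (s + 1) (envConv d X f) p ≤ sobolevTerm s (envConv d X f) p
        + 2 * ‖κ‖ ^ 2 * sobolevTerm s (envConv d (deriv X) f) p
        + 2 * sobolevTerm s (envConv d X fun q => (q : ℂ) * f q) p := by
      intro p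
      rw [sobolevTerm_succ, add_assoc]
      refine add_le_add le_rfl ?_
      simp only [sobolevTerm]
      rw [mul_envConv hd hX₁ hper (fun x => by simpa using hM 0 (Nat.zero_le _) x)
        (fun x => by simpa using hM 1 (Nat.succ_le_succ (Nat.zero_le s)) x)
        (summable_norm_sq_of_sobolevTerm hf₀) (summable_norm_sq_of_sobolevTerm hf₁), ← hκ]
      set a := κ * envConv d (deriv X) f p with ha
      set b := envConv d X (fun q => (q : ℂ) * f q) p
      have h₁ : ‖a + b‖ ^ 2 ≤ 2 * ‖a‖ ^ 2 + 2 * ‖b‖ ^ 2 := by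
        have := norm_add_le a b
        have := norm_nonneg (a + b)
        nlinarith [sq_nonneg (‖a‖ - ‖b‖)]
      have h₂ : ‖a‖ ^ 2 = ‖κ‖ ^ 2 * ‖envConv d (deriv X) f p‖ ^ 2 := by
        rw [ha, norm_mul, mul_pow]
      rw [h₂] at h₁
      refine (mul_le_mul_of_nonneg_left h₁ (by positivity : 0 ≤ (1 + (p : ℝ) ^ 2) ^ s)).trans_eq ?_
      ring
    have hB₂ := hB.mul_left (2 * ‖κ‖ ^ 2)
    have hC₂ := hC.mul_left 2
    have hsum := (hA.add hB₂).add hC₂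
    have hS : Summable (sobolevTerm (s + 1) (envConv d X f)) :=
      hsum.of_nonneg_of_le (sobolevTerm_nonneg _ _) hle
    refine ⟨hS, (hS.tsum_le_tsum hle hsum).trans ?_⟩
    rw [(hA.add hB₂).tsum_add hC₂, hA.tsum_add hB₂, tsum_mul_left, tsum_mul_left]
    have hsplit : ∑' p, sobolevTerm (s + 1) f p
        = ∑' p, sobolevTerm s f p + ∑' p, sobolevTerm s (fun q => (q : ℂ) * f q) p := by
      rw [← hf₀.tsum_add hf₁]
      exact tsum_congr (sobolevTerm_succ s f)
    rw [hsplit]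
    set S₀ := ∑' p, sobolevTerm s f p
    set S₁ := ∑' p, sobolevTerm s (fun q => (q : ℂ) * f q) p
    have hS₀ : 0 ≤ S₀ := tsum_nonneg (sobolevTerm_nonneg s _)
    have hS₁ : 0 ≤ S₁ := tsum_nonneg (sobolevTerm_nonneg s _)
    have hKM : 0 ≤ K * M ^ 2 := by positivity
    have e₁ := mul_le_mul_of_nonneg_left hB' (by positivity : 0 ≤ 2 * ‖κ‖ ^ 2)
    have e₂ : 0 ≤ K * M ^ 2 * S₀ := by positivity
    have e₃ : 0 ≤ (1 + 2 * ‖κ‖ ^ 2) * (K * M ^ 2 * S₁) := by positivity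
    nlinarith

end Sobolev

section Recursion

theorem norm_gamC_le {k : ℝ} (hk : 0 < k) (a : ℝ) : ‖gamC k a‖ ≤ |a| + k := by
  unfold gamC
  split_ifs with h
  · rw [Complex.norm_real, Real.norm_of_nonneg (Real.sqrt_nonneg _)]
    refine Real.sqrt_le_iff.mpr ⟨by positivity, ?_⟩
    nlinarith [sq_nonneg a, abs_nonneg a, sq_abs a]
  · rw [norm_mul, Complex.norm_I, one_mul, Complex.norm_real,
      Real.norm_of_nonneg (Real.sqrt_nonneg _)]
    refine Real.sqrt_le_iff.mpr ⟨by positivity, ?_⟩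
    nlinarith [sq_nonneg k, abs_nonneg a, sq_abs a]

/-- Under nonresonance the determinant grows quadratically in the mode number. -/
theorem one_add_sq_le_mul_norm_DeltaTE {d α ku kw k₀ X₀ : ℝ} (hd : 0 < d) (hku : 0 < ku)
    (hkw : 0 < kw) (hk₀ : 0 < k₀) (hX₀ : X₀ ≠ 0) {σl σn : ℂ} (hσn : σn ≠ 0) {μ : ℝ} (hμ : 0 < μ)
    (hres : ∀ p : ℤ, μ ≤ ‖DeltaTE d α ku kw k₀ X₀ σl σn p‖) :
    ∃ A : ℝ, 0 < A ∧ ∀ p : ℤ,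
      1 + (p : ℝ) ^ 2 ≤ A * ‖DeltaTE d α ku kw k₀ X₀ σl σn p‖ := by
  set a₀ : ℝ := k₀ * ‖σn‖ * |X₀| with ha₀
  set b : ℝ := ku + kw + k₀ * ‖σl‖ * |X₀| with hb
  have ha₀pos : 0 < a₀ := by
    have := norm_pos_iff.mpr hσn
    have := abs_pos.mpr hX₀
    positivity
  have hbpos : 0 < b := by positivity
  set B : ℝ := b + 2 / a₀ with hB
  have hBpos : 0 < B := by positivity
  set r : ℝ := d / (2 * π) with hr
  have hrpos : 0 < r := by positivity
  refine ⟨(1 + 2 * r ^ 2 * α ^ 2) / μ + 2 * r ^ 2 * (2 / a₀ * (1 + B / μ)), by positivity,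
    fun p => ?_⟩
  set a : ℝ := α + (2 * π / d) * p with ha
  set Δ := DeltaTE d α ku kw k₀ X₀ σl σn p with hΔ
  have hp : (p : ℝ) = r * (a - α) := by
    rw [ha, hr]
    field_simp
    ring
  have hlead : a₀ * a ^ 2 ≤ ‖Δ‖ + 2 * |a| + b := by
    have hsplit : Complex.I * (k₀ : ℂ) * σn * (X₀ : ℂ) * ((a ^ 2 : ℝ) : ℂ)
        = -Δ + (-Complex.I * gamC ku a) + (-Complex.I * gamC kw a)
          + (-(Complex.I * (k₀ : ℂ) * σl * (X₀ : ℂ))) := by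
      rw [hΔ, DeltaTE]
      ring
    have hnorm : ‖Complex.I * (k₀ : ℂ) * σn * (X₀ : ℂ) * ((a ^ 2 : ℝ) : ℂ)‖ = a₀ * a ^ 2 := by
      simp only [norm_mul, Complex.norm_I, Complex.norm_real, Real.norm_eq_abs, abs_of_pos hk₀,
        abs_of_nonneg (sq_nonneg a), one_mul, ha₀]
    rw [← hnorm, hsplit]
    refine (norm_add₄_le).trans ?_
    have h₁ : ‖-Complex.I * gamC ku a‖ ≤ |a| + ku := by
      simpa using norm_gamC_le hku a
    have h₂ : ‖-Complex.I * gamC kw a‖ ≤ |a| + kw := by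
      simpa using norm_gamC_le hkw a
    have h₃ : ‖-(Complex.I * (k₀ : ℂ) * σl * (X₀ : ℂ))‖ = k₀ * ‖σl‖ * |X₀| := by
      simp [abs_of_pos hk₀]
    rw [norm_neg, h₃]
    linarith
  have habs : 2 * |a| ≤ a₀ / 2 * a ^ 2 + 2 / a₀ := by
    have h : a₀ / 2 * a ^ 2 + 2 / a₀ - 2 * |a| = (a₀ * |a| - 2) ^ 2 / (2 * a₀) := by
      rw [← sq_abs a]
      field_simp
      ring
    have : 0 ≤ (a₀ * |a| - 2) ^ 2 / (2 * a₀) := by positivity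
    linarith
  have hone : 1 ≤ ‖Δ‖ / μ := (one_le_div hμ).mpr (hres p)
  have hasq : a ^ 2 ≤ 2 / a₀ * (1 + B / μ) * ‖Δ‖ := by
    have h : a₀ / 2 * a ^ 2 ≤ ‖Δ‖ + B * (‖Δ‖ / μ) := by nlinarith
    calc a ^ 2 = 2 / a₀ * (a₀ / 2 * a ^ 2) := by field_simp
      _ ≤ 2 / a₀ * (‖Δ‖ + B * (‖Δ‖ / μ)) := by gcongr
      _ = _ := by ring
  have hpsq : (p : ℝ) ^ 2 ≤ 2 * r ^ 2 * α ^ 2 + 2 * r ^ 2 * a ^ 2 := by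
    rw [hp, mul_pow]
    nlinarith [mul_nonneg (sq_nonneg r) (sq_nonneg (a + α))]
  calc 1 + (p : ℝ) ^ 2 ≤ (1 + 2 * r ^ 2 * α ^ 2) * 1 + 2 * r ^ 2 * a ^ 2 := by linarith
    _ ≤ (1 + 2 * r ^ 2 * α ^ 2) * (‖Δ‖ / μ)
        + 2 * r ^ 2 * (2 / a₀ * (1 + B / μ) * ‖Δ‖) := by gcongr
    _ = _ := by ring

/-- The Fourier symbol of the conductivity operator `σ̂_loc − σ̂_nloc ∂ₓ²`. -/
noncomputable def condSymbol (d α : ℝ) (σl σn : ℂ) (q : ℤ) : ℂ :=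
  σl + σn * ((((α + (2 * π / d) * q) ^ 2 : ℝ)) : ℂ)

theorem norm_condSymbol_le {d : ℝ} (hd : 0 < d) (α : ℝ) (σl : ℂ) {σn : ℂ} (hσn : σn ≠ 0) :
    ∃ B : ℝ, 0 < B ∧ ∀ q : ℤ, ‖condSymbol d α σl σn q‖ ≤ B * (1 + (q : ℝ) ^ 2) := by
  set r : ℝ := 2 * π / d
  have hr : 0 < r := by positivity
  have hσ := norm_pos_iff.mpr hσn
  refine ⟨‖σl‖ + ‖σn‖ * (2 * α ^ 2 + 2 * r ^ 2), by positivity, fun q => ?_⟩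
  have h₁ : ‖condSymbol d α σl σn q‖ ≤ ‖σl‖ + ‖σn‖ * (α + r * q) ^ 2 := by
    refine (norm_add_le _ _).trans_eq ?_
    rw [norm_mul, Complex.norm_real, Real.norm_of_nonneg (sq_nonneg _)]
  have h₂ : (α + r * q) ^ 2 ≤ (2 * α ^ 2 + 2 * r ^ 2) * (1 + (q : ℝ) ^ 2) := by
    nlinarith [sq_nonneg (α - r * q), sq_nonneg (α * q), sq_nonneg r]
  calc ‖condSymbol d α σl σn q‖ ≤ ‖σl‖ + ‖σn‖ * (α + r * q) ^ 2 := h₁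
    _ ≤ ‖σl‖ * (1 + (q : ℝ) ^ 2) + ‖σn‖ * ((2 * α ^ 2 + 2 * r ^ 2) * (1 + (q : ℝ) ^ 2)) := by
        gcongr
        nlinarith [norm_nonneg σl, sq_nonneg (q : ℝ)]
    _ = _ := by ring

/-- The jump datum `ξ` at order zero, in Fourier coefficients. -/
noncomputable def teJump (ℓ : ℕ) (p : ℤ) : ℂ :=
  if ℓ = 0 then (if p = 0 then (-1 : ℂ) else 0) else 0

/-- The right-hand side of the scalar equation for `W₀` after elimination of `U₀`. -/
noncomputable def teSource (ku α : ℝ) (p : ℤ) : ℂ :=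
  if p = 0 then -(2 * Complex.I * gamC ku α) else 0

/-- Eliminating `U_ℓ` reduces the recursion to a scalar equation with symbol `DeltaTE`. -/
theorem teRec_iff (d α ku kw k₀ X₀ : ℝ) (σl σn : ℂ) (X₁ : ℝ → ℝ)
    (UW : ℕ → (ℤ → ℂ) × (ℤ → ℂ)) :
    teRec d α ku kw k₀ X₀ σl σn X₁ UW ↔
      (∀ ℓ p, (UW ℓ).1 p = (UW ℓ).2 p + teJump ℓ p) ∧
      (∀ p, DeltaTE d α ku kw k₀ X₀ σl σn p * (UW 0).2 p = teSource ku α p) ∧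
      ∀ ℓ p, DeltaTE d α ku kw k₀ X₀ σl σn p * (UW (ℓ + 1)).2 p =
        Complex.I * k₀ * envConv d X₁ (fun q => condSymbol d α σl σn q * (UW ℓ).2 q) p := by
  unfold teRec
  constructor
  · intro h
    have hU : ∀ ℓ p, (UW ℓ).1 p = (UW ℓ).2 p + teJump ℓ p := fun ℓ p => by
      rw [teJump, ← (h ℓ p).1]
      ring
    refine ⟨hU, fun p => ?_, fun ℓ p => ?_⟩
    · have h₂ := (h 0 p).2
      rw [hU] at h₂
      by_cases hp : p = 0
      · subst hp
        simp [teJump, teSource, DeltaTE] at h₂ ⊢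
        linear_combination h₂
      · simp only [teJump, teSource, DeltaTE, hp, if_true, if_false, neg_zero, add_zero] at h₂ ⊢
        linear_combination h₂
    · have h₂ := (h (ℓ + 1) p).2
      rw [hU] at h₂
      simp only [teJump, Nat.add_eq_zero_iff, one_ne_zero, and_false, if_false, add_zero,
        Nat.add_sub_cancel, mul_assoc (envCoeff _ _ _)] at h₂
      rw [envConv]
      simp only [condSymbol]
      rw [← h₂, DeltaTE]
      ring
  · rintro ⟨hU, h₀, h₁⟩ ℓ p
    refine ⟨?_, ?_⟩
    · rw [hU, teJump]
      ring
    · rw [hU]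
      cases ℓ with
      | zero =>
        have h₂ := h₀ p
        by_cases hp : p = 0
        · subst hp
          simp [teJump, teSource, DeltaTE] at h₂ ⊢
          linear_combination h₂
        · simp only [teJump, teSource, DeltaTE, hp, if_true, if_false, neg_zero, add_zero] at h₂ ⊢
          linear_combination h₂
      | succ ℓ =>
        have h₂ := h₁ ℓ p
        rw [envConv] at h₂
        simp only [condSymbol] at h₂
        simp only [teJump, Nat.add_eq_zero_iff, one_ne_zero, and_false, if_false, add_zero,
          Nat.add_sub_cancel, mul_assoc (envCoeff _ _ _)]
        rw [← h₂, DeltaTE]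
        ring

/-- The solution `W_ℓ` of the scalar recursion. -/
noncomputable def teW (d α ku kw k₀ X₀ : ℝ) (σl σn : ℂ) (X₁ : ℝ → ℝ) : ℕ → ℤ → ℂ
  | 0 => fun p => teSource ku α p / DeltaTE d α ku kw k₀ X₀ σl σn p
  | ℓ + 1 => fun p => Complex.I * k₀ * envConv d X₁
      (fun q => condSymbol d α σl σn q * teW d α ku kw k₀ X₀ σl σn X₁ ℓ q) p /
        DeltaTE d α ku kw k₀ X₀ σl σn p

theorem existsUnique_teRec (d α ku kw k₀ X₀ : ℝ) (σl σn : ℂ) (X₁ : ℝ → ℝ)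
    (hΔ : ∀ p, DeltaTE d α ku kw k₀ X₀ σl σn p ≠ 0) :
    ∃! UW : ℕ → (ℤ → ℂ) × (ℤ → ℂ), teRec d α ku kw k₀ X₀ σl σn X₁ UW := by
  set W := teW d α ku kw k₀ X₀ σl σn X₁ with hW
  refine ⟨fun ℓ => (fun p => W ℓ p + teJump ℓ p, W ℓ), ?_, fun UW h => ?_⟩
  · refine (teRec_iff ..).mpr ⟨fun ℓ p => rfl, fun p => ?_, fun ℓ p => ?_⟩
    · exact mul_div_cancel₀ _ (hΔ p)
    · exact mul_div_cancel₀ _ (hΔ p)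
  · obtain ⟨hU, h₀, h₁⟩ := (teRec_iff ..).mp h
    have hWeq : ∀ ℓ, (UW ℓ).2 = W ℓ := by
      intro ℓ
      induction ℓ with
      | zero =>
        funext p
        exact (eq_div_iff (hΔ p)).mpr (by rw [mul_comm, h₀ p])
      | succ ℓ ih =>
        funext p
        refine (eq_div_iff (hΔ p)).mpr ?_
        rw [mul_comm, h₁ ℓ p, ih]
    funext ℓ
    refine Prod.ext ?_ (hWeq ℓ)
    funext p
    rw [hU, hWeq]

/-- One step of the recursion is bounded on the Sobolev space of order `s + 2` by a multiple of
the Hölder norm of the envelope. -/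
theorem exists_sobolevTerm_step {d α ku kw k₀ X₀ : ℝ} (hd : 0 < d) (hku : 0 < ku)
    (hkw : 0 < kw) (hk₀ : 0 < k₀) (hX₀ : X₀ ≠ 0) (s : ℕ) {σl σn : ℂ} (hσn : σn ≠ 0) {μ : ℝ}
    (hμ : 0 < μ) (hres : ∀ p : ℤ, μ ≤ ‖DeltaTE d α ku kw k₀ X₀ σl σn p‖) :
    ∃ C : ℝ, 0 < C ∧ ∀ X₁ : ℝ → ℝ, ContDiff ℝ s X₁ → Function.Periodic X₁ d →
      ∀ V W : ℤ → ℂ, Summable (sobolevTerm (s + 2) V) →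
      (∀ p, DeltaTE d α ku kw k₀ X₀ σl σn p * W p =
        Complex.I * k₀ * envConv d X₁ (fun q => condSymbol d α σl σn q * V q) p) →
      Summable (sobolevTerm (s + 2) W) ∧
        ∑' p, sobolevTerm (s + 2) W p ≤
          (C * holderNorm s X₁) ^ 2 * ∑' p, sobolevTerm (s + 2) V p := by
  obtain ⟨A, hA, hAle⟩ := one_add_sq_le_mul_norm_DeltaTE hd hku hkw hk₀ hX₀ hσn hμ hres
  obtain ⟨B, hB, hBle⟩ := norm_condSymbol_le hd α σl hσn
  obtain ⟨K, hK, hKle⟩ := sobolev_envConv_bound hd s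
  refine ⟨A * k₀ * B * √K, by positivity, fun X₁ hX hper V W hV hW => ?_⟩
  set g : ℤ → ℂ := fun q => condSymbol d α σl σn q * V q with hg
  have hgle : ∀ q, sobolevTerm s g q ≤ B ^ 2 * sobolevTerm (s + 2) V q := by
    intro q
    have h : ‖g q‖ ^ 2 ≤ (B * (1 + (q : ℝ) ^ 2) * ‖V q‖) ^ 2 := by
      rw [hg, norm_mul]
      gcongr
      exact hBle q
    refine (mul_le_mul_of_nonneg_left h (by positivity : 0 ≤ (1 + (q : ℝ) ^ 2) ^ s)).trans_eq ?_
    rw [sobolevTerm]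
    ring
  have hgsum : Summable (sobolevTerm s g) :=
    (hV.mul_left (B ^ 2)).of_nonneg_of_le (sobolevTerm_nonneg s g) hgle
  obtain ⟨hc, hcle⟩ := hKle X₁ (holderNorm s X₁) hX hper
    (fun j hj x => abs_iteratedDeriv_le_holderNorm hd hX hper hj x) g hgsum
  have hWle : ∀ p, sobolevTerm (s + 2) W p ≤ (A * k₀) ^ 2 * sobolevTerm s (envConv d X₁ g) p := by
    intro p
    have hnorm : ‖DeltaTE d α ku kw k₀ X₀ σl σn p‖ * ‖W p‖ = k₀ * ‖envConv d X₁ g p‖ := by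
      rw [← norm_mul, hW p]
      simp [abs_of_pos hk₀]
    have h : (1 + (p : ℝ) ^ 2) * ‖W p‖ ≤ A * k₀ * ‖envConv d X₁ g p‖ := by
      calc (1 + (p : ℝ) ^ 2) * ‖W p‖ ≤ A * ‖DeltaTE d α ku kw k₀ X₀ σl σn p‖ * ‖W p‖ := by
            gcongr
            exact hAle p
        _ = A * k₀ * ‖envConv d X₁ g p‖ := by rw [mul_assoc, hnorm, mul_assoc]
    calc sobolevTerm (s + 2) W p = (1 + (p : ℝ) ^ 2) ^ s * ((1 + (p : ℝ) ^ 2) * ‖W p‖) ^ 2 := by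
          rw [sobolevTerm]
          ring
      _ ≤ (1 + (p : ℝ) ^ 2) ^ s * (A * k₀ * ‖envConv d X₁ g p‖) ^ 2 := by gcongr
      _ = _ := by
          rw [sobolevTerm]
          ring
  have hWsum : Summable (sobolevTerm (s + 2) W) :=
    (hc.mul_left _).of_nonneg_of_le (sobolevTerm_nonneg _ _) hWle
  refine ⟨hWsum, ?_⟩
  calc ∑' p, sobolevTerm (s + 2) W p
      ≤ (A * k₀) ^ 2 * ∑' p, sobolevTerm s (envConv d X₁ g) p := by
        rw [← tsum_mul_left]
        exact hWsum.tsum_le_tsum hWle (hc.mul_left _)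
    _ ≤ (A * k₀) ^ 2 * (K * holderNorm s X₁ ^ 2 * ∑' p, sobolevTerm s g p) := by gcongr
    _ ≤ (A * k₀) ^ 2 * (K * holderNorm s X₁ ^ 2 * (B ^ 2 * ∑' p, sobolevTerm (s + 2) V p)) := by
        gcongr
        rw [← tsum_mul_left]
        exact hgsum.tsum_le_tsum hgle (hV.mul_left _)
    _ = _ := by
        simp only [mul_pow, Real.sq_sqrt hK.le]
        ring

theorem rpow_mul_norm_sq_eq_sobolevTerm (s m : ℕ) (f : ℤ → ℂ) (p : ℤ) :
    (1 + |(p : ℝ)| ^ 2) ^ ((s : ℝ) + m) * ‖f p‖ ^ 2 = sobolevTerm (s + m) f p := by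
  rw [sobolevTerm, sq_abs, ← Nat.cast_add, Real.rpow_natCast]

theorem summable_sobolevTerm_of_eq_zero (s : ℕ) {f : ℤ → ℂ} (hf : ∀ p ≠ 0, f p = 0) :
    Summable (sobolevTerm s f) :=
  summable_of_ne_finset_zero (s := {0}) fun p hp => by
    simp [sobolevTerm, hf p (by simpa using hp)]

end Recursion

/-- Theorem 4.6: under nonresonance and `X₀ ≠ 0`, for a `d`-periodic
envelope perturbation `X₁ ∈ C^s`, the TE HOPE recursion has a unique solution,
its terms lie in `H^{s+1} × H^{s+2}` and satisfy `‖U_ℓ‖_{H^{s+1}} ≤ C_U D^ℓ`,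
`‖W_ℓ‖_{H^{s+2}} ≤ C_W D^ℓ` for every `D > C|X₁|_{C^s}`; in particular the series
`Σ_ℓ U_ℓ δ^ℓ`, `Σ_ℓ W_ℓ δ^ℓ` converge for `δ·C·|X₁|_{C^s} < 1`. -/
theorem te_hope_analyticity (d α ku kw k₀ X₀ : ℝ)
    (hd : 0 < d) (hku : 0 < ku) (hkw : 0 < kw) (hk₀ : 0 < k₀) (hX₀ : X₀ ≠ 0)
    (s : ℕ) (σl σn : ℂ) (hσn : σn ≠ 0)
    (μ : ℝ) (hμ : 0 < μ)
    (hres : ∀ p : ℤ, μ ≤ ‖DeltaTE d α ku kw k₀ X₀ σl σn p‖)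
    (X₁ : ℝ → ℝ) (hX₁smooth : ContDiff ℝ (s : ℕ∞) X₁)
    (hX₁per : Function.Periodic X₁ d) :
    (∃! UW : ℕ → (ℤ → ℂ) × (ℤ → ℂ), teRec d α ku kw k₀ X₀ σl σn X₁ UW) ∧
    ∀ UW : ℕ → (ℤ → ℂ) × (ℤ → ℂ), teRec d α ku kw k₀ X₀ σl σn X₁ UW →
      (∀ ℓ : ℕ,
        Summable (fun p : ℤ => (1 + |(p : ℝ)| ^ 2) ^ ((s : ℝ) + 1) * ‖(UW ℓ).1 p‖ ^ 2) ∧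
        Summable (fun p : ℤ => (1 + |(p : ℝ)| ^ 2) ^ ((s : ℝ) + 2) * ‖(UW ℓ).2 p‖ ^ 2)) ∧
      ∃ CU CW C : ℝ, 0 < CU ∧ 0 < CW ∧ 0 < C ∧
        (∀ D : ℝ, C * holderNorm s X₁ < D → ∀ ℓ : ℕ,
          Real.sqrt (hnormSq ((s : ℝ) + 1) (UW ℓ).1) ≤ CU * D ^ ℓ ∧
          Real.sqrt (hnormSq ((s : ℝ) + 2) (UW ℓ).2) ≤ CW * D ^ ℓ) ∧
        ∀ δ : ℝ, 0 ≤ δ → δ * (C * holderNorm s X₁) < 1 →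
          Summable (fun ℓ : ℕ => Real.sqrt (hnormSq ((s : ℝ) + 1) (UW ℓ).1) * δ ^ ℓ) ∧
          Summable (fun ℓ : ℕ => Real.sqrt (hnormSq ((s : ℝ) + 2) (UW ℓ).2) * δ ^ ℓ) := by
  have hΔ : ∀ p, DeltaTE d α ku kw k₀ X₀ σl σn p ≠ 0 := fun p =>
    norm_pos_iff.mp (hμ.trans_le (hres p))
  have hX : ContDiff ℝ s X₁ := by exact_mod_cast hX₁smooth
  refine ⟨existsUnique_teRec d α ku kw k₀ X₀ σl σn X₁ hΔ, fun UW h => ?_⟩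
  obtain ⟨hU, h₀, h₁⟩ := (teRec_iff ..).mp h
  obtain ⟨C, hC, hstep⟩ := exists_sobolevTerm_step (α := α) (σl := σl) hd hku hkw hk₀ hX₀ s hσn hμ
    hres
  have hterm₁ : ∀ f : ℤ → ℂ, (fun p : ℤ => (1 + |(p : ℝ)| ^ 2) ^ ((s : ℝ) + 1) * ‖f p‖ ^ 2)
      = sobolevTerm (s + 1) f := fun f => funext fun p => by
    simpa using rpow_mul_norm_sq_eq_sobolevTerm s 1 f p
  have hterm₂ : ∀ f : ℤ → ℂ, (fun p : ℤ => (1 + |(p : ℝ)| ^ 2) ^ ((s : ℝ) + 2) * ‖f p‖ ^ 2)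
      = sobolevTerm (s + 2) f := fun f => funext fun p => by
    simpa using rpow_mul_norm_sq_eq_sobolevTerm s 2 f p
  simp only [hnormSq, hterm₁, hterm₂]
  set H := holderNorm s X₁
  have hH : 0 ≤ H :=
    (abs_nonneg _).trans (abs_iteratedDeriv_le_holderNorm hd hX hX₁per (Nat.zero_le s) 0)
  have hCH : 0 ≤ C * H := by positivity
  have hW₀ : ∀ p ≠ 0, (UW 0).2 p = 0 := fun p hp => by
    have := h₀ p
    rw [teSource, if_neg hp] at this
    exact (mul_eq_zero.mp this).resolve_left (hΔ p)
  have hWsum : ∀ ℓ, Summable (sobolevTerm (s + 2) (UW ℓ).2) := by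
    intro ℓ
    induction ℓ with
    | zero => exact summable_sobolevTerm_of_eq_zero _ hW₀
    | succ ℓ ih => exact (hstep X₁ hX hX₁per _ _ ih (h₁ ℓ)).1
  have hUsucc : ∀ ℓ, (UW (ℓ + 1)).1 = (UW (ℓ + 1)).2 := fun ℓ => funext fun p => by
    simp [hU, teJump]
  have hlow : ∀ f : ℤ → ℂ, Summable (sobolevTerm (s + 2) f) → Summable (sobolevTerm (s + 1) f) :=
    fun f hf => hf.of_nonneg_of_le (sobolevTerm_nonneg _ _) (sobolevTerm_mono (by lia) f)
  have hUsum : ∀ ℓ, Summable (sobolevTerm (s + 1) (UW ℓ).1) := by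
    rintro (_ | ℓ)
    · refine summable_sobolevTerm_of_eq_zero _ fun p hp => ?_
      rw [hU, hW₀ p hp, teJump, if_pos rfl, if_neg hp, add_zero]
    · rw [hUsucc]
      exact hlow _ (hWsum _)
  set NU : ℕ → ℝ := fun ℓ => √(∑' p, sobolevTerm (s + 1) (UW ℓ).1 p)
  set NW : ℕ → ℝ := fun ℓ => √(∑' p, sobolevTerm (s + 2) (UW ℓ).2 p)
  have hNU₀ : 0 ≤ NU 0 := Real.sqrt_nonneg _
  have hNW₀ : 0 ≤ NW 0 := Real.sqrt_nonneg _
  have hNWbound : ∀ ℓ, NW ℓ ≤ NW 0 * (C * H) ^ ℓ := by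
    intro ℓ
    induction ℓ with
    | zero => simp
    | succ ℓ ih =>
      calc NW (ℓ + 1) ≤ √((C * H) ^ 2 * ∑' p, sobolevTerm (s + 2) (UW ℓ).2 p) :=
            Real.sqrt_le_sqrt (hstep X₁ hX hX₁per _ _ (hWsum ℓ) (h₁ ℓ)).2
        _ = C * H * NW ℓ := by rw [Real.sqrt_mul (sq_nonneg _), Real.sqrt_sq hCH]
        _ ≤ C * H * (NW 0 * (C * H) ^ ℓ) := by gcongr
        _ = NW 0 * (C * H) ^ (ℓ + 1) := by ring
  have hNUbound : ∀ ℓ, NU ℓ ≤ (NU 0 + NW 0) * (C * H) ^ ℓ := by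
    rintro (_ | ℓ)
    · simpa using hNW₀
    · calc NU (ℓ + 1) ≤ NW (ℓ + 1) := by
            refine Real.sqrt_le_sqrt ?_
            rw [hUsucc]
            exact (hlow _ (hWsum _)).tsum_le_tsum (sobolevTerm_mono (by lia) _) (hWsum _)
        _ ≤ NW 0 * (C * H) ^ (ℓ + 1) := hNWbound _
        _ ≤ (NU 0 + NW 0) * (C * H) ^ (ℓ + 1) := by
            gcongr
            linarith
  refine ⟨fun ℓ => ⟨hUsum ℓ, hWsum ℓ⟩, NU 0 + NW 0 + 1, NW 0 + 1, C, by positivity,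
    by positivity, hC, fun D hD ℓ => ⟨(hNUbound ℓ).trans ?_, (hNWbound ℓ).trans ?_⟩,
    fun δ hδ hδC => ?_⟩
  · exact mul_le_mul (by linarith) (pow_le_pow_left₀ hCH hD.le ℓ) (by positivity) (by positivity)
  · exact mul_le_mul (by linarith) (pow_le_pow_left₀ hCH hD.le ℓ) (by positivity) (by positivity)
  · have hgeom : ∀ c : ℝ, Summable fun ℓ : ℕ => c * (δ * (C * H)) ^ ℓ := fun c =>
      (summable_geometric_of_lt_one (by positivity) hδC).mul_left c
    have hseries : ∀ (N : ℕ → ℝ) (c : ℝ), (∀ ℓ, 0 ≤ N ℓ) → (∀ ℓ, N ℓ ≤ c * (C * H) ^ ℓ) →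
        Summable fun ℓ => N ℓ * δ ^ ℓ := fun N c hN hNc => by
      refine (hgeom c).of_nonneg_of_le (fun ℓ => mul_nonneg (hN ℓ) (by positivity)) fun ℓ => ?_
      calc N ℓ * δ ^ ℓ ≤ c * (C * H) ^ ℓ * δ ^ ℓ := by
            gcongr
            exact hNc ℓ
        _ = c * (δ * (C * H)) ^ ℓ := by
            rw [mul_pow δ]
            ring
    exact ⟨hseries NU _ (fun _ => Real.sqrt_nonneg _) hNUbound,
      hseries NW _ (fun _ => Real.sqrt_nonneg _) hNWbound⟩
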